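/- arXiv:1401.6869 — 2 statements merged into one kernel-verified Lean document; each statement's English description precedes it below -/
import Mathlib

section
/- Suppose that the proper function f : X → (−∞,+∞] is a c-antiderivative of the mapping M : X ⇉ Y and that ∅ ≠ S ⊆ dom M. If h : X → (−∞,+∞] is any proper function with G(M) ⊆ G(∂_c h) and h|_S = f|_S, then α_{[c,f|_S,M]} ≤ h pointwise and h^c ∈ 𝒜_{[c,f^c|_{M(S)},M⁻¹]}. If, in addition, h is c-convex, then h ∈ 𝒜_{[c,f|_S,M]} if and only if h^c ∈ 𝒜_{[c,f^c|_{M(S)},M⁻¹]}. -/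
/-- A function into `(-∞,+∞]` (modeled as `EReal` never taking `⊥`) is proper if it is
finite somewhere. -/
def EProper {A : Type*} (f : A → EReal) : Prop :=
  (∀ a, f a ≠ ⊥) ∧ ∃ a, f a ≠ ⊤

/-- The `c`-transform `f^c(b) = sup_a (c(a,b) - f(a))`. -/
noncomputable def cTransform {A B : Type*} (k : A → B → ℝ) (f : A → EReal) : B → EReal :=
  fun b => ⨆ a, (k a b : EReal) - f a

/-- The `c`-subdifferential `∂_c f(a) = {b | ∀ a', f(a) + c(a',b) ≤ f(a') + c(a,b)}`. -/
def cSubdiff {A B : Type*} (k : A → B → ℝ) (f : A → EReal) (a : A) : Set B :=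
  {b | ∀ a', f a + (k a' b : EReal) ≤ f a' + (k a b : EReal)}

/-- A proper function `f` is `c`-convex if it is the `c`-transform of some
`(-∞,+∞]`-valued function on the other set. -/
def CConvexWith {A B : Type*} (k : A → B → ℝ) (f : A → EReal) : Prop :=
  EProper f ∧ ∃ g : B → EReal, (∀ b, g b ≠ ⊥) ∧ f = cTransform (fun b a => k a b) g

/-- `f` is a `c`-antiderivative of `M` if `G(M) ⊆ G(∂_c f)`. -/
def IsCAntideriv {A B : Type*} (k : A → B → ℝ) (f : A → EReal) (M : A → Set B) : Prop :=
  ∀ a b, b ∈ M a → b ∈ cSubdiff k f a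

/-- The family `𝒜_{[c,f|_S,M]}` of all `c`-convex `c`-antiderivatives of `M`
agreeing with `f` on `S`. -/
def AFam {A B : Type*} (k : A → B → ℝ) (f : A → EReal) (S : Set A) (M : A → Set B) :
    Set (A → EReal) :=
  {h | CConvexWith k h ∧ IsCAntideriv k h M ∧ ∀ s ∈ S, h s = f s}

theorem EProper.ne_top_of_mem_cSubdiff {A B : Type*} {k : A → B → ℝ} {f : A → EReal}
    (hf : EProper f) {a : A} {b : B} (hb : b ∈ cSubdiff k f a) : f a ≠ ⊤ := by
  obtain ⟨hbot, a₀, ha₀⟩ := hf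
  intro htop
  have h := hb a₀
  rw [htop, EReal.top_add_coe, top_le_iff] at h
  exact EReal.add_ne_top ha₀ (EReal.coe_ne_top _) h

/-- Equality in the Fenchel–Young inequality holds along the `c`-subdifferential. -/
theorem cTransform_eq_of_mem_cSubdiff {A B : Type*} {k : A → B → ℝ} {f : A → EReal}
    (hf : EProper f) {a : A} {b : B} (hb : b ∈ cSubdiff k f a) :
    cTransform k f b = (k a b : EReal) - f a := by
  refine le_antisymm (iSup_le fun a' => ?_) (le_iSup (fun a' => (k a' b : EReal) - f a') a)
  have h := hb a'
  have h1 := hf.1 a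
  have h2 := hf.ne_top_of_mem_cSubdiff hb
  have h3 := hf.1 a'
  generalize f a = u at *
  generalize f a' = v at *
  lift u to ℝ using ⟨h2, h1⟩
  induction v with
  | bot => exact absurd rfl h3
  | top => simp
  | coe v =>
    norm_cast at h ⊢
    linarith

theorem cTransform_ne_bot {A B : Type*} {k : A → B → ℝ} {f : A → EReal}
    (hf : EProper f) (b : B) : cTransform k f b ≠ ⊥ := by
  obtain ⟨hbot, a₀, ha₀⟩ := hf
  have h := le_iSup (fun a' => (k a' b : EReal) - f a') a₀
  have h1 := hbot a₀
  generalize f a₀ = u at *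
  lift u to ℝ using ⟨ha₀, h1⟩
  exact ne_bot_of_le_ne_bot (EReal.coe_ne_bot (k a₀ b - u)) (by exact_mod_cast h)

theorem cTransform_cTransform_le {A B : Type*} {k : A → B → ℝ} {f : A → EReal}
    (hf : ∀ a, f a ≠ ⊥) (a : A) :
    cTransform (fun b a => k a b) (cTransform k f) a ≤ f a := by
  refine iSup_le fun b => ?_
  have h : (k a b : EReal) - f a ≤ cTransform k f b :=
    le_iSup (fun a' => (k a' b : EReal) - f a') a
  have h1 := hf a
  generalize cTransform k f b = v at *
  generalize f a = u at *
  induction u with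
  | bot => exact absurd rfl h1
  | top => simp
  | coe u =>
    induction v with
    | bot =>
      rw [← EReal.coe_sub] at h
      exact absurd (le_bot_iff.1 h) (EReal.coe_ne_bot _)
    | top => simp
    | coe v =>
      norm_cast at h ⊢
      linarith

theorem mem_cSubdiff_cTransform {A B : Type*} {k : A → B → ℝ} {f : A → EReal}
    (hf : EProper f) {a : A} {b : B} (hb : b ∈ cSubdiff k f a) :
    a ∈ cSubdiff (fun b a => k a b) (cTransform k f) b := by
  intro b'
  have h : (k a b' : EReal) - f a ≤ cTransform k f b' :=
    le_iSup (fun a' => (k a' b' : EReal) - f a') a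
  have h1 := hf.1 a
  have h2 := hf.ne_top_of_mem_cSubdiff hb
  rw [cTransform_eq_of_mem_cSubdiff hf hb]
  generalize cTransform k f b' = v at *
  generalize f a = u at *
  lift u to ℝ using ⟨h2, h1⟩
  induction v with
  | bot =>
    rw [← EReal.coe_sub] at h
    exact absurd (le_bot_iff.1 h) (EReal.coe_ne_bot _)
  | top => simp
  | coe v =>
    norm_cast at h ⊢
    linarith

theorem cConvexWith_cTransform {A B : Type*} {k : A → B → ℝ} {f : A → EReal}
    (hf : EProper f) {a : A} {b : B} (hb : b ∈ cSubdiff k f a) :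
    CConvexWith (fun b a => k a b) (cTransform k f) := by
  refine ⟨⟨cTransform_ne_bot hf, b, ?_⟩, f, hf.1, rfl⟩
  have h1 := hf.1 a
  have h2 := hf.ne_top_of_mem_cSubdiff hb
  rw [cTransform_eq_of_mem_cSubdiff hf hb]
  generalize f a = u at *
  lift u to ℝ using ⟨h2, h1⟩
  exact EReal.coe_ne_top (k a b - u)

/-- The double `c`-transform leaves `f` unchanged where `∂_c f` is nonempty. -/
theorem cTransform_cTransform_eq {A B : Type*} {k : A → B → ℝ} {f : A → EReal}
    (hf : EProper f) {a : A} {b : B} (hb : b ∈ cSubdiff k f a) :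
    cTransform (fun b a => k a b) (cTransform k f) a = f a := by
  rw [cTransform_eq_of_mem_cSubdiff (cConvexWith_cTransform hf hb).1
    (mem_cSubdiff_cTransform hf hb), cTransform_eq_of_mem_cSubdiff hf hb]
  have h1 := hf.1 a
  have h2 := hf.ne_top_of_mem_cSubdiff hb
  generalize f a = u at *
  lift u to ℝ using ⟨h2, h1⟩
  norm_cast
  ring


/-- any function `h` solving the constrained problem majorizes the lower
envelope `α_{[c,f|_S,M]}`, its `c`-transform lies in the dual family
`𝒜_{[c,f^c|_{M(S)},M⁻¹]}`, and for `c`-convex `h` membership in the two families is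
equivalent under the `c`-transform. -/
theorem AFam_duality_membership {X Y : Type*} [Nonempty X] [Nonempty Y]
    (c : X → Y → ℝ) (f : X → EReal) (hf : EProper f) (M : X → Set Y)
    (hanti : IsCAntideriv c f M) (S : Set X) (hS : S.Nonempty)
    (hSdom : ∀ s ∈ S, (M s).Nonempty)
    (h : X → EReal) (hhp : EProper h) (hha : IsCAntideriv c h M)
    (hhS : ∀ s ∈ S, h s = f s) :
    (∀ x, (⨅ h' ∈ AFam c f S M, h' x) ≤ h x) ∧
    cTransform c h ∈
      AFam (fun y x => c x y) (cTransform c f) (⋃ s ∈ S, M s) (fun y => {x | y ∈ M x}) ∧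
    (CConvexWith c h →
      (h ∈ AFam c f S M ↔
        cTransform c h ∈
          AFam (fun y x => c x y) (cTransform c f) (⋃ s ∈ S, M s)
            (fun y => {x | y ∈ M x}))) := by
  obtain ⟨s₀, hs₀⟩ := hS
  obtain ⟨y₀, hy₀⟩ := hSdom s₀ hs₀
  have hsub := hha s₀ y₀ hy₀
  have hconv := cConvexWith_cTransform hhp hsub
  have hdual : cTransform c h ∈
      AFam (fun y x => c x y) (cTransform c f) (⋃ s ∈ S, M s) (fun y => {x | y ∈ M x}) := by
    refine ⟨hconv, fun y x hxy => mem_cSubdiff_cTransform hhp (hha x y hxy), fun y hy => ?_⟩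
    simp only [Set.mem_iUnion] at hy
    obtain ⟨s, hs, hys⟩ := hy
    rw [cTransform_eq_of_mem_cSubdiff hhp (hha s y hys),
      cTransform_eq_of_mem_cSubdiff hf (hanti s y hys), hhS s hs]
  refine ⟨fun x => ?_, hdual, fun hc => ⟨fun _ => hdual, fun _ => ⟨hc, hha, hhS⟩⟩⟩
  refine (iInf₂_le (cTransform (fun y x => c x y) (cTransform c h)) ?_).trans
    (cTransform_cTransform_le hhp.1 x)
  refine ⟨cConvexWith_cTransform hconv.1 (mem_cSubdiff_cTransform hhp hsub),
    fun x y hxy => mem_cSubdiff_cTransform hconv.1 (mem_cSubdiff_cTransform hhp (hha x y hxy)),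
    fun s hs => ?_⟩
  obtain ⟨y, hy⟩ := hSdom s hs
  rw [cTransform_cTransform_eq hhp (hha s y hy), hhS s hs]
end

section
/- Suppose that the proper function f : X → (−∞,+∞] is a c-antiderivative of the mapping M : X ⇉ Y with dom M ≠ ∅, and take S = dom M. Then the upper envelope satisfies γ_{[c,f|_{dom M},M]} = (f + ι_{dom M})^{cc}, where ι_{dom M} is the indicator function of dom M (0 on dom M, +∞ elsewhere). -/
theorem EReal.coe_sub_le_comm (r : ℝ) (a b : EReal) :
    (r : EReal) - a ≤ b ↔ (r : EReal) - b ≤ a := by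
  induction a <;> induction b <;> simp [← EReal.coe_sub]
  constructor <;> intro h <;> linarith

theorem cTransform_le_iff {A B : Type*} (k : A → B → ℝ) (f : A → EReal) (g : B → EReal) :
    cTransform k f ≤ g ↔ cTransform (fun b a => k a b) g ≤ f := by
  simp only [Pi.le_def, cTransform, iSup_le_iff]
  rw [forall_comm]
  simp only [EReal.coe_sub_le_comm]

theorem coe_sub_le_cTransform {A B : Type*} (k : A → B → ℝ) (f : A → EReal) (a : A) (b : B) :
    (k a b : EReal) - f a ≤ cTransform k f b :=
  le_iSup (fun a => (k a b : EReal) - f a) a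

theorem cTransform_antitone {A B : Type*} (k : A → B → ℝ) {f g : A → EReal} (h : f ≤ g) :
    cTransform k g ≤ cTransform k f :=
  fun _ => iSup_mono fun a => EReal.sub_le_sub le_rfl (h a)

theorem IsCAntideriv.ne_top {A B : Type*} {k : A → B → ℝ} {f : A → EReal} {M : A → Set B}
    (hf : EProper f) (h : IsCAntideriv k f M) {a : A} (ha : (M a).Nonempty) : f a ≠ ⊤ := by
  obtain ⟨b, hb⟩ := ha
  obtain ⟨a', ha'⟩ := hf.2
  intro htop
  have h1 := h a b hb a'
  lift f a' to ℝ using ⟨ha', hf.1 a'⟩ with r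
  rw [htop, EReal.top_add_coe, ← EReal.coe_add] at h1
  exact EReal.coe_ne_top _ (top_le_iff.mp h1)

/-- A `c`-convex minorant of `f` lies below the `c`-biconjugate `f^{cc}`. -/
theorem CConvexWith.le_biconjugate {A B : Type*} {k : A → B → ℝ} {h f : A → EReal}
    (hh : CConvexWith k h) (hle : h ≤ f) :
    h ≤ cTransform (fun b a => k a b) (cTransform k f) := by
  obtain ⟨-, g, -, rfl⟩ := hh
  exact cTransform_antitone _ ((cTransform_le_iff k f g).mpr hle)

theorem biconjugate_mem_AFam {A B : Type*} {k : A → B → ℝ} {f F : A → EReal} {M : A → Set B}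
    (hf : EProper f) (hanti : IsCAntideriv k f M) (hdom : ∃ a, (M a).Nonempty)
    (hF : ∀ a, (M a).Nonempty → F a = f a) (hF' : ∀ a, ¬ (M a).Nonempty → F a = ⊤) :
    cTransform (fun b a => k a b) (cTransform k F) ∈ AFam k f {a | (M a).Nonempty} M := by
  set g := cTransform k F with hg
  set G := cTransform (fun b a => k a b) g with hG
  have hGF : G ≤ F := (cTransform_le_iff k F g).mp le_rfl
  have hgle : ∀ a b, b ∈ M a → g b ≤ (k a b : EReal) - f a := by
    intro a b hb
    refine iSup_le fun s => ?_
    have hfa := hanti.ne_top hf ⟨b, hb⟩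
    have h1 := hanti a b hb s
    by_cases hs : (M s).Nonempty
    · have hfs := hanti.ne_top hf hs
      rw [hF s hs]
      lift f a to ℝ using ⟨hfa, hf.1 a⟩ with r
      lift f s to ℝ using ⟨hfs, hf.1 s⟩ with t
      norm_cast at h1 ⊢
      linarith
    · simp [hF' s hs]
  have hlow : ∀ a b, b ∈ M a → ∀ a', (k a' b : EReal) - ((k a b : EReal) - f a) ≤ G a' :=
    fun a b hb a' => (EReal.sub_le_sub le_rfl (hgle a b hb)).trans
      (coe_sub_le_cTransform (fun b a => k a b) g b a')
  have hGf : ∀ a, (M a).Nonempty → G a = f a := by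
    rintro a ⟨b, hb⟩
    refine le_antisymm ((hGF a).trans_eq (hF a ⟨b, hb⟩)) ?_
    refine le_trans ?_ (hlow a b hb a)
    have hfa := hanti.ne_top hf ⟨b, hb⟩
    lift f a to ℝ using ⟨hfa, hf.1 a⟩ with r
    norm_cast
    linarith
  obtain ⟨a₀, b₀, hb₀⟩ := hdom
  have hfa₀ := hanti.ne_top hf ⟨b₀, hb₀⟩
  refine ⟨⟨⟨fun a ha => ?_, a₀, ?_⟩, g, fun b hb => ?_, rfl⟩, fun a b hb a' => ?_, hGf⟩
  · have h1 := hlow a₀ b₀ hb₀ a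
    rw [ha] at h1
    lift f a₀ to ℝ using ⟨hfa₀, hf.1 a₀⟩ with r
    norm_cast at h1
  · rwa [hGf a₀ ⟨b₀, hb₀⟩]
  · have h1 := coe_sub_le_cTransform k F a₀ b
    rw [← hg, hb, hF a₀ ⟨b₀, hb₀⟩] at h1
    lift f a₀ to ℝ using ⟨hfa₀, hf.1 a₀⟩ with r
    norm_cast at h1
  · have h1 := hlow a b hb a'
    have hfa := hanti.ne_top hf ⟨b, hb⟩
    rw [hGf a ⟨b, hb⟩]
    lift f a to ℝ using ⟨hfa, hf.1 a⟩ with r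
    refine le_trans (le_of_eq ?_) (add_le_add_left h1 (k a b : EReal))
    norm_cast
    ring

open Classical in
/-- with `S = dom M`, the upper envelope satisfies
`γ_{[c,f|_{dom M},M]} = (f + ι_{dom M})^{cc}`. -/
theorem upperEnvelope_eq_cConvexification_of_domEq {X Y : Type*} [Nonempty X] [Nonempty Y]
    (c : X → Y → ℝ) (f : X → EReal) (hf : EProper f) (M : X → Set Y)
    (hanti : IsCAntideriv c f M) (hdom : ∃ x, (M x).Nonempty) :
    (fun x => ⨆ h ∈ AFam c f {x | (M x).Nonempty} M, h x) =
      cTransform (fun y x => c x y)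
        (cTransform c (fun x => f x + (if (M x).Nonempty then (0 : EReal) else ⊤))) := by
  have hF : ∀ x, (M x).Nonempty →
      f x + (if (M x).Nonempty then (0 : EReal) else ⊤) = f x := fun x hx => by simp [hx]
  have hF' : ∀ x, ¬ (M x).Nonempty →
      f x + (if (M x).Nonempty then (0 : EReal) else ⊤) = ⊤ := fun x hx => by
    rw [if_neg hx, EReal.add_top_of_ne_bot (hf.1 x)]
  funext x
  refine le_antisymm (iSup₂_le fun h hh => hh.1.le_biconjugate (fun s => ?_) x) ?_
  · by_cases hs : (M s).Nonempty
    · exact (hh.2.2 s hs).trans_le (hF s hs).ge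
    · exact le_top.trans_eq (hF' s hs).symm
  · exact le_iSup₂_of_le _ (biconjugate_mem_AFam hf hanti hdom hF hF') le_rfl
end
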